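/- Let R denote the hyperfinite II₁ factor and let M be a II₁ McDuff factor, i.e., M ⊗ R ≅ M. Let α : M ⊗ R → M be an isomorphism, let β : M → M ⊗ R be the monomorphism β(m) = m ⊗ 1, and set θ = β ∘ α, an endomorphism of the II₁ factor M ⊗ R with θ(M ⊗ R) = M ⊗ 1. Then θ(M ⊗ R) ∨ J θ(M ⊗ R) J = B(L²(M)) ⊗ 1 is a type I factor (where J = J_M ⊗ J_R is the modular conjugation of M ⊗ R with respect to its trace), and hence θ is extendable with respect to the trace. -/

import Mathlib

set_option synthInstance.maxHeartbeats 400000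
set_option maxHeartbeats 1000000

open scoped InnerProductSpace ComplexConjugate

noncomputable section

namespace Paper

variable {H : Type} [NormedAddCommGroup H] [InnerProductSpace ℂ H] [CompleteSpace H]
variable {H' : Type} [NormedAddCommGroup H'] [InnerProductSpace ℂ H'] [CompleteSpace H']

open scoped InnerProductSpace ComplexConjugate

/-- An operator is a (self-adjoint, idempotent) orthogonal projection. -/
def IsProjection (p : H →L[ℂ] H) : Prop := IsSelfAdjoint p ∧ p * p = p

/-- The vector state determined by a vector `Ω`. -/
def vecState (Ω : H) (x : H →L[ℂ] H) : ℂ := ⟪x Ω, Ω⟫_ℂ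

/-- A normal state on a von Neumann algebra, described via its canonical form as a
countable convex combination of vector states. -/
def IsNormalState (M : Set (H →L[ℂ] H)) (φ : (H →L[ℂ] H) → ℂ) : Prop :=
  ∃ ξ : ℕ → H, (Summable fun n => ‖ξ n‖ ^ 2) ∧ (∑' n, ‖ξ n‖ ^ 2) = 1 ∧
    ∀ x ∈ M, φ x = ∑' n, ⟪x (ξ n), ξ n⟫_ℂ

/-- Normality (complete additivity) of a map between operator algebras: it is `σ`-weakly
continuous, equivalently it preserves sums of orthogonal families of projections lying in the
given domain `S`. -/
def IsNormalMapOn (S : Set (H →L[ℂ] H)) (Θ : (H →L[ℂ] H) → (H' →L[ℂ] H')) : Prop :=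
  ∀ {ι : Type} (p : ι → (H →L[ℂ] H)) (q : H →L[ℂ] H),
    (∀ i, p i ∈ S) → q ∈ S →
    (∀ i, IsProjection (p i)) → (∀ i k, i ≠ k → p i * p k = 0) →
    (∀ ξ : H, HasSum (fun i => p i ξ) (q ξ)) →
    ∀ ξ : H', HasSum (fun i => Θ (p i) ξ) (Θ q ξ)

/-- `Θ` is a `*`-homomorphism on the subset `S` (typically a von Neumann algebra). -/
structure IsStarHomOn (S : Set (H →L[ℂ] H)) (Θ : (H →L[ℂ] H) → (H' →L[ℂ] H')) : Prop where
  map_add : ∀ x ∈ S, ∀ y ∈ S, Θ (x + y) = Θ x + Θ y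
  map_smul : ∀ (c : ℂ), ∀ x ∈ S, Θ (c • x) = c • Θ x
  map_mul : ∀ x ∈ S, ∀ y ∈ S, Θ (x * y) = Θ x * Θ y
  map_star : ∀ x ∈ S, Θ (star x) = star (Θ x)

/-- The (self-adjoint part of the) center of `S` is trivial. -/
def IsFactorSet (S : Set (H →L[ℂ] H)) : Prop :=
  ∀ x ∈ S, (∀ y ∈ S, x * y = y * x) → ∃ c : ℂ, x = c • (1 : H →L[ℂ] H)

/-- A type `I` factor: a factor possessing a minimal projection. -/
def IsTypeIFactorSet (S : Set (H →L[ℂ] H)) : Prop :=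
  IsFactorSet S ∧ ∃ p ∈ S, p ≠ 0 ∧ IsProjection p ∧
    ∀ q ∈ S, IsProjection q → q * p = q → q = 0 ∨ q = p

/-- `z` is the central support of the normal state `φ` of the von Neumann algebra `S`, i.e. the
smallest central projection of full measure. -/
structure IsCentralSupport (S : Set (H →L[ℂ] H)) (φ : (H →L[ℂ] H) → ℂ) (z : H →L[ℂ] H) :
    Prop where
  mem : z ∈ S
  proj : IsProjection z
  central : ∀ y ∈ S, z * y = y * z
  full : φ z = 1
  min : ∀ w ∈ S, IsProjection w → (∀ y ∈ S, w * y = y * w) → φ w = 1 → z * w = z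

/-- The von Neumann algebra generated by a (self-adjoint) set of operators. -/
def vN (S : Set (H →L[ℂ] H)) : Set (H →L[ℂ] H) := Set.centralizer (Set.centralizer S)

/-- Standard form data for a von Neumann algebra `M` with cyclic separating unit vector `Ω`:
`J` is the modular conjugation (an antiunitary involution fixing `Ω`, conjugating `M` onto its
commutant, and positive on the cone `{x j(x) Ω}`), and `j = J (·) J`. -/
structure StandardForm (M : VonNeumannAlgebra H) (Ω : H) (J : H → H)
    (j : (H →L[ℂ] H) → (H →L[ℂ] H)) : Prop where
  unit : ‖Ω‖ = 1
  cyclic : Dense {ξ : H | ∃ x ∈ M, x Ω = ξ}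
  separating : ∀ x ∈ M, x Ω = 0 → x = 0
  Jadd : ∀ ξ η : H, J (ξ + η) = J ξ + J η
  Jsmul : ∀ (c : ℂ) (ξ : H), J (c • ξ) = (starRingEnd ℂ) c • J ξ
  Jinvol : ∀ ξ : H, J (J ξ) = ξ
  Jinner : ∀ ξ η : H, ⟪J ξ, J η⟫_ℂ = ⟪η, ξ⟫_ℂ
  JΩ : J Ω = Ω
  jdef : ∀ (x : H →L[ℂ] H) (ξ : H), j x ξ = J (x (J ξ))
  jmapsTo : ∀ x ∈ M, j x ∈ Set.centralizer (M : Set (H →L[ℂ] H))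
  jsurj : ∀ y ∈ Set.centralizer (M : Set (H →L[ℂ] H)), ∃ x ∈ M, j x = y
  pos : ∀ x ∈ M, 0 ≤ (⟪(x * j x) Ω, Ω⟫_ℂ).re ∧ (⟪(x * j x) Ω, Ω⟫_ℂ).im = 0

/-- A unital `*`-endomorphism of `M` preserving the (faithful, normal) vector state of `Ω`. -/
structure StateEndo (M : VonNeumannAlgebra H) (Ω : H)
    (θ : (H →L[ℂ] H) → (H →L[ℂ] H)) : Prop where
  mapsTo : Set.MapsTo θ (M : Set (H →L[ℂ] H)) (M : Set (H →L[ℂ] H))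
  unital : θ 1 = 1
  hom : IsStarHomOn (M : Set (H →L[ℂ] H)) θ
  state : ∀ x ∈ M, ⟪θ x Ω, Ω⟫_ℂ = ⟪x Ω, Ω⟫_ℂ

/-- `u` is the isometry of the GNS space implementing `θ`:  `u x Ω = θ(x) Ω`. -/
def Implements (M : VonNeumannAlgebra H) (Ω : H) (θ : (H →L[ℂ] H) → (H →L[ℂ] H))
    (u : H →L[ℂ] H) : Prop :=
  (∀ ξ : H, ‖u ξ‖ = ‖ξ‖) ∧ ∀ x ∈ M, u (x Ω) = θ x Ω

/-- `u` commutes with the modular conjugation `J`. -/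
def CommutesWithJ (J : H → H) (u : H →L[ℂ] H) : Prop := ∀ ξ : H, u (J ξ) = J (u ξ)

/-- `θ` is equi-modular: its implementing isometry commutes with `J`. -/
def EquiModular (M : VonNeumannAlgebra H) (Ω : H) (J : H → H)
    (θ : (H →L[ℂ] H) → (H →L[ℂ] H)) : Prop :=
  ∃ u : H →L[ℂ] H, Implements M Ω θ u ∧ CommutesWithJ J u

/-- `Θ = θ⁽²⁾` is a unital normal `*`-endomorphism of `B(L²(M,φ))` extending `θ` and
`j ∘ θ ∘ j`. -/
structure IsExtension (M : VonNeumannAlgebra H) (j : (H →L[ℂ] H) → (H →L[ℂ] H))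
    (θ : (H →L[ℂ] H) → (H →L[ℂ] H)) (Θ : (H →L[ℂ] H) → (H →L[ℂ] H)) : Prop where
  hom : IsStarHomOn (Set.univ : Set (H →L[ℂ] H)) Θ
  unital : Θ 1 = 1
  normal : IsNormalMapOn (Set.univ : Set (H →L[ℂ] H)) Θ
  onM : ∀ x ∈ M, Θ x = θ x
  onComm : ∀ x ∈ M, Θ (j x) = j (θ x)

/-- `θ` is extendable. -/
def Extendable (M : VonNeumannAlgebra H) (j : (H →L[ℂ] H) → (H →L[ℂ] H))
    (θ : (H →L[ℂ] H) → (H →L[ℂ] H)) : Prop :=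
  ∃ Θ : (H →L[ℂ] H) → (H →L[ℂ] H), IsExtension M j θ Θ

/-- An `E₀`-semigroup on the von Neumann probability space `(M, ⟨·Ω,Ω⟩)`. -/
structure IsE0Semigroup (M : VonNeumannAlgebra H) (Ω : H)
    (α : ℝ → (H →L[ℂ] H) → (H →L[ℂ] H)) : Prop where
  endo : ∀ t : ℝ, 0 ≤ t → StateEndo M Ω (α t)
  id0 : ∀ x ∈ M, α 0 x = x
  semigroup : ∀ s t : ℝ, 0 ≤ s → 0 ≤ t → ∀ x ∈ M, α s (α t x) = α (s + t) x
  weakCont : ∀ x ∈ M, ∀ ξ η : H, ContinuousOn (fun t : ℝ => ⟪α t x ξ, η⟫_ℂ) (Set.Ici 0)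

set_option linter.unusedSectionVars false
open scoped TensorProduct

section Abstract

theorem pos_isom_eq_one (U : H →L[ℂ] H) (hn : ∀ ξ, ‖U ξ‖ = ‖ξ‖)
    (hp : ∀ ξ, 0 ≤ (⟪U ξ, ξ⟫_ℂ).re ∧ (⟪U ξ, ξ⟫_ℂ).im = 0) (ξ : H) : U ξ = ξ := by
  have hpos : U.IsPositive := by
    rw [ContinuousLinearMap.isPositive_iff_complex]
    intro x
    refine ⟨?_, (hp x).1⟩
    apply Complex.ext
    · simp
    · simpa using (hp x).2.symm
  have hsa : ContinuousLinearMap.adjoint U = U := hpos.isSelfAdjoint.adjoint_eq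
  have h1 : ContinuousLinearMap.adjoint U ∘L U = 1 :=
    (ContinuousLinearMap.norm_map_iff_adjoint_comp_self U).1 hn
  rw [hsa] at h1
  have h2 : U (U ξ) = ξ := by
    simpa using congrArg (fun T : H →L[ℂ] H => T ξ) h1
  have h3 : U (ξ - U ξ) = -(ξ - U ξ) := by rw [map_sub, h2]; abel
  have h4 := (hp (ξ - U ξ)).1
  rw [h3, inner_neg_left, inner_self_eq_norm_sq_to_K, Complex.neg_re] at h4
  have h5 : ‖ξ - U ξ‖ ^ 2 ≤ 0 := by
    have : (((‖ξ - U ξ‖ : ℂ)) ^ 2).re = ‖ξ - U ξ‖ ^ 2 := by norm_cast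
    simp only [Complex.coe_algebraMap] at h4
    rw [this] at h4
    linarith
  have h6 : ‖ξ - U ξ‖ = 0 := by nlinarith [norm_nonneg (ξ - U ξ)]
  exact (sub_eq_zero.1 (norm_eq_zero.1 h6)).symm

variable {E K L : Type} [NormedAddCommGroup E] [InnerProductSpace ℂ E] [CompleteSpace E]
  [NormedAddCommGroup K] [InnerProductSpace ℂ K] [CompleteSpace K]
  [NormedAddCommGroup L] [InnerProductSpace ℂ L] [CompleteSpace L]

/-- Extension of `T ⊗ G` along a dense isometry of the algebraic tensor product. -/
def tens (V : E ⊗[ℂ] K →ₗᵢ[ℂ] L) (T : E →L[ℂ] E) (G : K →L[ℂ] K) : L →L[ℂ] L :=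
  (V.toLinearMap ∘ₗ (TensorProduct.mapL T G).toLinearMap).extendOfNorm V.toLinearMap

variable (V : E ⊗[ℂ] K →ₗᵢ[ℂ] L)

theorem tens_V (hV : DenseRange V) (T : E →L[ℂ] E) (G : K →L[ℂ] K) (x : E ⊗[ℂ] K) :
    tens V T G (V x) = V (TensorProduct.mapL T G x) := by
  refine LinearMap.extendOfNorm_eq (f := V.toLinearMap ∘ₗ (TensorProduct.mapL T G).toLinearMap)
    (e := V.toLinearMap) hV ⟨‖TensorProduct.mapL T G‖, fun x => ?_⟩ x
  have : ‖TensorProduct.mapL T G x‖ ≤ _ := (TensorProduct.mapL T G).le_opNorm x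
  simpa using this

theorem tens_tmul (hV : DenseRange V) (T : E →L[ℂ] E) (G : K →L[ℂ] K) (ξ : E) (η : K) :
    tens V T G (V (ξ ⊗ₜ η)) = V (T ξ ⊗ₜ G η) := by
  rw [tens_V V hV, TensorProduct.mapL_tmul]

theorem ext_V (hV : DenseRange V) {S T : L →L[ℂ] L} (h : ∀ ξ η, S (V (ξ ⊗ₜ η)) = T (V (ξ ⊗ₜ η))) : S = T := by
  ext z
  refine hV.induction_on (p := fun z => S z = T z) z
    (isClosed_eq S.continuous T.continuous) ?_
  intro x
  induction x with
  | zero => simp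
  | tmul a b => exact h a b
  | add a b ha hb => simp [ha, hb]

theorem ext_inner_V (hV : DenseRange V) {S T : L →L[ℂ] L}
    (h : ∀ ξ η ξ' η', ⟪V (ξ' ⊗ₜ η'), S (V (ξ ⊗ₜ η))⟫_ℂ = ⟪V (ξ' ⊗ₜ η'), T (V (ξ ⊗ₜ η))⟫_ℂ) :
    S = T := by
  refine ext_V V hV fun ξ η => ?_
  refine ext_inner_left ℂ fun z => ?_
  refine hV.induction_on (p := fun z => ⟪z, S (V (ξ ⊗ₜ η))⟫_ℂ = ⟪z, T (V (ξ ⊗ₜ η))⟫_ℂ) z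
    (isClosed_eq (by fun_prop) (by fun_prop)) ?_
  intro x
  induction x with
  | zero => simp
  | tmul a b => exact h _ _ a b
  | add a b ha hb => simp only [map_add, inner_add_left, ha, hb]

theorem inner_V (ξ ξ' : E) (η η' : K) :
    ⟪V (ξ ⊗ₜ η), V (ξ' ⊗ₜ η')⟫_ℂ = ⟪ξ, ξ'⟫_ℂ * ⟪η, η'⟫_ℂ := by
  rw [V.inner_map_map, TensorProduct.inner_tmul]

theorem tens_norm (hV : DenseRange V) (T : E →L[ℂ] E) : ‖tens V T 1‖ ≤ ‖T‖ := by
  refine ContinuousLinearMap.opNorm_le_bound _ (norm_nonneg _) ?_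
  refine LinearMap.norm_extendOfNorm_apply_le
    (f := V.toLinearMap ∘ₗ (TensorProduct.mapL T 1).toLinearMap)
    (e := V.toLinearMap) hV ‖T‖ fun x => ?_
  have h1 : ‖TensorProduct.mapL T (1 : K →L[ℂ] K) x‖ ≤ _ :=
    (TensorProduct.mapL T 1).le_opNorm x
  have h2 : ‖TensorProduct.mapL T (1 : K →L[ℂ] K)‖ ≤ ‖T‖ := by
    refine (TensorProduct.norm_mapL_le _ _).trans ?_
    exact mul_le_of_le_one_right (norm_nonneg _) ContinuousLinearMap.norm_id_le
  have h3 : ‖TensorProduct.mapL T (1 : K →L[ℂ] K) x‖ ≤ ‖T‖ * ‖x‖ :=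
    h1.trans (mul_le_mul_of_nonneg_right h2 (norm_nonneg _))
  simpa using h3

theorem tens_add (hV : DenseRange V) (S T : E →L[ℂ] E) : tens V (S + T) 1 = tens V S 1 + tens V T 1 := by
  refine ext_V V hV fun ξ η => ?_
  simp [tens_tmul V hV, TensorProduct.add_tmul]

theorem tens_smul (hV : DenseRange V) (c : ℂ) (T : E →L[ℂ] E) : tens V (c • T) 1 = c • tens V T 1 := by
  refine ext_V V hV fun ξ η => ?_
  simp only [tens_tmul V hV, smul_apply, ← TensorProduct.smul_tmul', map_smul]

theorem tens_mul (hV : DenseRange V) (S T : E →L[ℂ] E) : tens V (S * T) 1 = tens V S 1 * tens V T 1 := by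
  refine ext_V V hV fun ξ η => ?_
  simp [tens_tmul V hV]

theorem tens_one (hV : DenseRange V) : tens V (1 : E →L[ℂ] E) 1 = 1 := by
  refine ext_V V hV fun ξ η => ?_
  simp [tens_tmul V hV]

theorem tens_star (hV : DenseRange V) (T : E →L[ℂ] E) : tens V (star T) 1 = star (tens V T 1) := by
  refine ext_inner_V V hV fun ξ η ξ' η' => ?_
  rw [ContinuousLinearMap.star_eq_adjoint (tens V T 1), ContinuousLinearMap.adjoint_inner_right,
    tens_tmul V hV, tens_tmul V hV, inner_V, inner_V, ContinuousLinearMap.star_eq_adjoint,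
    ContinuousLinearMap.adjoint_inner_right]
  simp

theorem tens_inj (hV : DenseRange V) {S T : E →L[ℂ] E} (η₀ : K) (hη : ‖η₀‖ = 1) (h : tens V S 1 = tens V T 1) :
    S = T := by
  ext ξ
  refine ext_inner_left ℂ fun ξ' => ?_
  have h1 := congrArg (fun R : L →L[ℂ] L => ⟪V (ξ' ⊗ₜ η₀), R (V (ξ ⊗ₜ η₀))⟫_ℂ) h
  simpa [tens_tmul V hV, inner_V, hη, inner_self_eq_norm_sq_to_K, -LinearIsometry.inner_map_map] using h1

theorem slice (hV : DenseRange V) (T : L →L[ℂ] L) (η₀ : K) (hη : ‖η₀‖ = 1)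
    (h : ∀ ξ ξ', ∃ c : ℂ, ∀ η η', ⟪V (ξ' ⊗ₜ η'), T (V (ξ ⊗ₜ η))⟫_ℂ = c * ⟪η', η⟫_ℂ) :
    ∃ R : E →L[ℂ] E, T = tens V R 1 := by
  let X : E →L[ℂ] L := V.toContinuousLinearMap ∘L ((TensorProduct.mkL ℂ E K).flip η₀)
  have hX : ∀ ξ, X ξ = V (ξ ⊗ₜ η₀) := fun ξ => rfl
  refine ⟨ContinuousLinearMap.adjoint X ∘L T ∘L X, ext_inner_V V hV fun ξ η ξ' η' => ?_⟩
  obtain ⟨c, hc⟩ := h ξ ξ'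
  rw [hc, tens_tmul V hV, inner_V]
  simp only [ContinuousLinearMap.comp_apply, one_apply_eq_self]
  rw [ContinuousLinearMap.adjoint_inner_right, hX, hX, hc, inner_self_eq_norm_sq_to_K, hη]
  simp

theorem tens_normal (hV : DenseRange V) : IsNormalMapOn (Set.univ : Set (E →L[ℂ] E)) (fun T => tens V T 1) := by
  intro ι p q _ _ hp horth hsum
  have hbd : ∀ s : Finset ι, ‖∑ i ∈ s, p i‖ ≤ 1 := by
    intro s
    have hproj : IsStarProjection (∑ i ∈ s, p i) := by
      classical
      constructor
      · show (∑ i ∈ s, p i) * (∑ i ∈ s, p i) = _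
        rw [Finset.sum_mul_sum]
        refine Finset.sum_congr rfl fun i hi => ?_
        rw [Finset.sum_eq_single i (fun k _ hk => horth i k hk.symm) (fun h => absurd hi h)]
        exact (hp i).2
      · exact isSelfAdjoint_sum _ fun i _ => (hp i).1
    exact hproj.norm_le
  have hsumt : ∀ s : Finset ι, ∑ i ∈ s, tens V (p i) 1 = tens V (∑ i ∈ s, p i) 1 := by
    classical
    intro s
    induction s using Finset.induction_on with
    | empty =>
      simp only [Finset.sum_empty]
      refine ext_V V hV fun ξ η => ?_
      simp [tens_tmul V hV]
    | insert a s ha ih => rw [Finset.sum_insert ha, Finset.sum_insert ha, ih, tens_add V hV]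
  have heq : Equicontinuous (fun (s : Finset ι) (z : L) => ∑ i ∈ s, tens V (p i) 1 z) := by
    have : ∀ s : Finset ι, LipschitzWith 1 (fun z : L => ∑ i ∈ s, tens V (p i) 1 z) := by
      intro s
      have h1 : (fun z : L => ∑ i ∈ s, tens V (p i) 1 z) = tens V (∑ i ∈ s, p i) 1 := by
        rw [← hsumt]; ext z; simp
      rw [h1]
      refine (tens V (∑ i ∈ s, p i) 1).lipschitzWith_of_opNorm_le ?_
      simpa using (tens_norm V hV _).trans (hbd s)
    exact (LipschitzWith.uniformEquicontinuous _ 1 this).equicontinuous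
  intro z
  have hcl := heq.isClosed_setOfPred_tendsto (l := (Filter.atTop : Filter (Finset ι))) (f := tens V q 1)
    (tens V q 1).continuous
  refine hV.induction_on (p := fun z => HasSum (fun i => tens V (p i) 1 z) (tens V q 1 z)) z
    hcl ?_
  intro x
  induction x with
  | zero => simp [hasSum_zero]
  | tmul a b =>
    simp only [tens_tmul V hV]
    have := (hsum a).mapL (V.toContinuousLinearMap ∘L ((TensorProduct.mkL ℂ E K).flip b))
    exact this
  | add a b ha hb => 
    simp only [map_add]
    exact ha.add hb


theorem tens_star2 (hV : DenseRange V) (T : E →L[ℂ] E) (G : K →L[ℂ] K) :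
    tens V (star T) (star G) = star (tens V T G) := by
  refine ext_inner_V V hV fun ξ η ξ' η' => ?_
  rw [ContinuousLinearMap.star_eq_adjoint (tens V T G), ContinuousLinearMap.adjoint_inner_right,
    tens_tmul V hV, tens_tmul V hV, inner_V, inner_V, ContinuousLinearMap.star_eq_adjoint,
    ContinuousLinearMap.star_eq_adjoint,
    ContinuousLinearMap.adjoint_inner_right, ContinuousLinearMap.adjoint_inner_right]

theorem tens_mul2 (hV : DenseRange V) (S T : E →L[ℂ] E) (F G : K →L[ℂ] K) :
    tens V (S * T) (F * G) = tens V S F * tens V T G := by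
  refine ext_V V hV fun ξ η => ?_
  simp [tens_tmul V hV]

theorem core_sub_range (hV : DenseRange V) (ξ₀ : E) (hξ : ‖ξ₀‖ = 1) (η₀ : K) (hη : ‖η₀‖ = 1)
    (SN : Set (E →L[ℂ] E)) (SK : Set (K →L[ℂ] K))
    (hirr : ∀ T ∈ Set.centralizer
      (((fun T => tens V T 1) '' SN) ∪ ((fun G => tens V 1 G) '' SK)),
      ∃ c : ℂ, T = c • (1 : L →L[ℂ] L))
    (T : L →L[ℂ] L) (hT : T ∈ Set.centralizer ((fun G => tens V 1 G) '' SK)) :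
    ∃ R : E →L[ℂ] E, T = tens V R 1 := by
  refine slice V hV T η₀ hη fun ξ ξ' => ?_
  let X : E → (K →L[ℂ] L) := fun ξ => V.toContinuousLinearMap ∘L (TensorProduct.mkL ℂ E K ξ)
  have hX : ∀ ξ η, X ξ η = V (ξ ⊗ₜ η) := fun ξ η => rfl
  let G : K →L[ℂ] K := ContinuousLinearMap.adjoint (X ξ') ∘L T ∘L X ξ
  have hG : ∀ η η', ⟪η', G η⟫_ℂ = ⟪V (ξ' ⊗ₜ η'), T (V (ξ ⊗ₜ η))⟫_ℂ := by
    intro η η'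
    simp only [G, ContinuousLinearMap.comp_apply]
    rw [ContinuousLinearMap.adjoint_inner_right, hX, hX]
  have hcomm : ∀ F ∈ SK, F * G = G * F := by
    intro F hF
    ext η
    refine ext_inner_left ℂ fun η' => ?_
    have h1 : tens V 1 F * T = T * tens V 1 F := hT _ ⟨F, hF, rfl⟩
    have h2 := congrArg (fun S : L →L[ℂ] L => ⟪V (ξ' ⊗ₜ η'), S (V (ξ ⊗ₜ η))⟫_ℂ) h1
    simp only [mul_apply_eq_comp, tens_tmul V hV, one_apply_eq_self] at h2
    rw [← ContinuousLinearMap.adjoint_inner_left, ← ContinuousLinearMap.star_eq_adjoint,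
      ← tens_star2 V hV, tens_tmul V hV] at h2
    simp only [star_one, one_apply_eq_self] at h2
    rw [← hG, ← hG, ContinuousLinearMap.star_eq_adjoint,
      ContinuousLinearMap.adjoint_inner_left] at h2
    exact h2
  obtain ⟨c, hc⟩ := hirr (tens V 1 G) (by
    rintro _ (⟨S, hS, rfl⟩ | ⟨F, hF, rfl⟩)
    · show tens V S 1 * tens V 1 G = tens V 1 G * tens V S 1
      rw [← tens_mul2 V hV, ← tens_mul2 V hV]; simp
    · show tens V 1 F * tens V 1 G = tens V 1 G * tens V 1 F
      rw [← tens_mul2 V hV, ← tens_mul2 V hV, hcomm F hF])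
  refine ⟨c, fun η η' => ?_⟩
  rw [← hG]
  have h3 := congrArg (fun S : L →L[ℂ] L => ⟪V (ξ₀ ⊗ₜ η'), S (V (ξ₀ ⊗ₜ η))⟫_ℂ) hc
  simp only [tens_tmul V hV, smul_apply, one_apply_eq_self, inner_V,
    inner_smul_right, inner_self_eq_norm_sq_to_K, hξ] at h3
  simpa using h3

theorem core_range_sub (hV : DenseRange V)
    (SN : Set (E →L[ℂ] E))
    (hirr : ∀ T ∈ Set.centralizer SN, ∃ c : ℂ, T = c • (1 : E →L[ℂ] E))
    (R : E →L[ℂ] E) :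
    tens V R 1 ∈ vN ((fun T => tens V T 1) '' SN) := by
  intro S hS
  have key : ∀ η η', ∃ c : ℂ, ∀ ξ ξ',
      ⟪V (ξ' ⊗ₜ η'), S (V (ξ ⊗ₜ η))⟫_ℂ = c * ⟪ξ', ξ⟫_ℂ := by
    intro η η'
    let X : K → (E →L[ℂ] L) := fun η =>
      V.toContinuousLinearMap ∘L ((TensorProduct.mkL ℂ E K).flip η)
    have hX : ∀ ξ η, X η ξ = V (ξ ⊗ₜ η) := fun ξ η => rfl
    let G : E →L[ℂ] E := ContinuousLinearMap.adjoint (X η') ∘L S ∘L X η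
    have hG : ∀ ξ ξ', ⟪ξ', G ξ⟫_ℂ = ⟪V (ξ' ⊗ₜ η'), S (V (ξ ⊗ₜ η))⟫_ℂ := by
      intro ξ ξ'
      simp only [G, ContinuousLinearMap.comp_apply]
      rw [ContinuousLinearMap.adjoint_inner_right, hX, hX]
    obtain ⟨c, hc⟩ := hirr G (by
      intro F hF
      ext ξ
      refine ext_inner_left ℂ fun ξ' => ?_
      have h1 : tens V F 1 * S = S * tens V F 1 := hS _ ⟨F, hF, rfl⟩
      have h2 := congrArg (fun S : L →L[ℂ] L => ⟪V (ξ' ⊗ₜ η'), S (V (ξ ⊗ₜ η))⟫_ℂ) h1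
      simp only [mul_apply_eq_comp, tens_tmul V hV, one_apply_eq_self] at h2
      rw [← ContinuousLinearMap.adjoint_inner_left, ← ContinuousLinearMap.star_eq_adjoint,
        ← tens_star V hV, tens_tmul V hV] at h2
      simp only [one_apply_eq_self] at h2
      rw [← hG, ← hG, ContinuousLinearMap.star_eq_adjoint,
        ContinuousLinearMap.adjoint_inner_left] at h2
      exact h2)
    refine ⟨c, fun ξ ξ' => ?_⟩
    rw [← hG, hc]
    simp
  refine ext_inner_V V hV fun ξ η ξ' η' => ?_
  obtain ⟨c, hc⟩ := key η η'
  simp only [mul_apply_eq_comp]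
  rw [← ContinuousLinearMap.adjoint_inner_left (tens V R 1),
    ← ContinuousLinearMap.star_eq_adjoint, ← tens_star V hV, tens_tmul V hV, tens_tmul V hV]
  simp only [one_apply_eq_self]
  rw [hc, hc, ContinuousLinearMap.star_eq_adjoint, ContinuousLinearMap.adjoint_inner_left]

theorem core_typeI (hV : DenseRange V) (ξ₀ : E) (hξ : ‖ξ₀‖ = 1) (η₀ : K) (hη : ‖η₀‖ = 1) :
    IsTypeIFactorSet (Set.range (fun T : E →L[ℂ] E => tens V T 1)) := by
  let P : E → E → (E →L[ℂ] E) := fun a b => (innerSL ℂ a).smulRight b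
  have hP : ∀ a b x, P a b x = ⟪a, x⟫_ℂ • b := fun a b x => by simp [P]
  have hξξ : ⟪ξ₀, ξ₀⟫_ℂ = 1 := by rw [inner_self_eq_norm_sq_to_K, hξ]; simp
  refine ⟨?_, tens V (P ξ₀ ξ₀) 1, ⟨_, rfl⟩, ?_, ?_, ?_⟩
  · rintro _ ⟨T, rfl⟩ h
    have hT : ∀ S, T * S = S * T := by
      intro S
      refine tens_inj V hV η₀ hη ?_
      rw [tens_mul V hV, tens_mul V hV]
      exact h _ ⟨S, rfl⟩
    refine ⟨⟪ξ₀, T ξ₀⟫_ℂ, ?_⟩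
    have : T = ⟪ξ₀, T ξ₀⟫_ℂ • (1 : E →L[ℂ] E) := by
      ext x
      have h1 := congrArg (fun S : E →L[ℂ] E => S ξ₀) (hT (P ξ₀ x))
      simp only [mul_apply_eq_comp, hP, hξξ, one_smul] at h1
      simpa using h1
    show tens V T 1 = _
    conv_lhs => rw [this]
    rw [tens_smul V hV, tens_one V hV]
  · intro h
    have h0 : tens V (0 : E →L[ℂ] E) 1 = 0 := by
      simpa using tens_smul V hV 0 (0 : E →L[ℂ] E)
    have h1 := tens_inj V hV η₀ hη (h.trans h0.symm)
    have h2 := congrArg (fun S : E →L[ℂ] E => S ξ₀) h1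
    simp only [hP, hξξ, one_smul] at h2
    have : ξ₀ = 0 := by simpa using h2
    simp [this] at hξ
  · constructor
    · show star (tens V (P ξ₀ ξ₀) 1) = _
      rw [← tens_star V hV]
      congr 1
      ext x
      refine ext_inner_left ℂ fun y => ?_
      rw [ContinuousLinearMap.star_eq_adjoint, ContinuousLinearMap.adjoint_inner_right]
      simp only [hP, inner_smul_left, inner_smul_right, inner_conj_symm]
      ring
    · rw [← tens_mul V hV]
      congr 1
      ext x
      simp [hP, hξ]
  · rintro _ ⟨Q, rfl⟩ ⟨hsa, hid⟩ hQP
    simp only at hsa hid hQP ⊢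
    have hid' : Q * Q = Q := tens_inj V hV η₀ hη (by rw [tens_mul V hV]; exact hid)
    have hsa' : star Q = Q := tens_inj V hV η₀ hη (by rw [tens_star V hV]; exact hsa)
    have hQP' : Q * P ξ₀ ξ₀ = Q := tens_inj V hV η₀ hη (by rw [tens_mul V hV]; exact hQP)
    have e1 : ∀ x, Q x = ⟪ξ₀, x⟫_ℂ • Q ξ₀ := by
      intro x
      conv_lhs => rw [← hQP']
      simp [hP]
    have e2 : Q ξ₀ = ⟪ξ₀, Q ξ₀⟫_ℂ • ξ₀ := by
      refine ext_inner_right ℂ fun y => ?_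
      have h1 : ⟪Q ξ₀, y⟫_ℂ = ⟪ξ₀, Q y⟫_ℂ := by
        conv_lhs => rw [← hsa']
        rw [ContinuousLinearMap.star_eq_adjoint, ContinuousLinearMap.adjoint_inner_left]
      have h2 : ⟪Q ξ₀, ξ₀⟫_ℂ = ⟪ξ₀, Q ξ₀⟫_ℂ := by
        conv_lhs => rw [← hsa']
        rw [ContinuousLinearMap.star_eq_adjoint, ContinuousLinearMap.adjoint_inner_left]
      rw [h1, e1, inner_smul_right, inner_smul_left, inner_conj_symm, h2]
      ring
    have e3 : Q = ⟪ξ₀, Q ξ₀⟫_ℂ • P ξ₀ ξ₀ := by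
      ext x
      rw [e1]
      conv_lhs => rw [e2]
      simp [hP, smul_smul, mul_comm]
    have e4 : ⟪ξ₀, Q ξ₀⟫_ℂ * ⟪ξ₀, Q ξ₀⟫_ℂ = ⟪ξ₀, Q ξ₀⟫_ℂ := by
      have h1 := congrArg (fun S : E →L[ℂ] E => ⟪ξ₀, S ξ₀⟫_ℂ) hid'
      simp only [mul_apply_eq_comp] at h1
      rw [e1 (Q ξ₀), inner_smul_right] at h1
      exact h1
    have e5 : ⟪ξ₀, Q ξ₀⟫_ℂ = 0 ∨ ⟪ξ₀, Q ξ₀⟫_ℂ = 1 := by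
      rcases eq_or_ne (⟪ξ₀, Q ξ₀⟫_ℂ) 0 with h | h
      · exact Or.inl h
      · exact Or.inr (mul_left_cancel₀ h (by rw [e4, mul_one]))
    rcases e5 with h | h
    · left
      rw [e3, h, tens_smul V hV, zero_smul]
    · right
      rw [e3, h, one_smul]

end Abstract

section Concrete

/-- Orbit map of a vector under a von Neumann algebra. -/
def orb (M : VonNeumannAlgebra H) (Ω : H) :
    M.toStarSubalgebra.toSubalgebra.toSubmodule →ₗ[ℂ] H :=
  (ContinuousLinearMap.apply ℂ H Ω).toLinearMap ∘ₗ Submodule.subtype _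

theorem orb_apply (M : VonNeumannAlgebra H) (Ω : H)
    (x : M.toStarSubalgebra.toSubalgebra.toSubmodule) :
    orb M Ω x = (x : H →L[ℂ] H) Ω := rfl

/-- The closed subspace generated by the orbit. -/
def orbSpace (M : VonNeumannAlgebra H) (Ω : H) : Submodule ℂ H :=
  (LinearMap.range (orb M Ω)).topologicalClosure

instance (M : VonNeumannAlgebra H) (Ω : H) : CompleteSpace (orbSpace M Ω) :=
  (Submodule.isClosed_topologicalClosure _).completeSpace_coe

theorem mem_orbSpace (M : VonNeumannAlgebra H) (Ω : H) {x : H →L[ℂ] H} (hx : x ∈ M) :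
    x Ω ∈ orbSpace M Ω :=
  Submodule.le_topologicalClosure _ ⟨⟨x, hx⟩, rfl⟩

theorem orbSpace_induction (M : VonNeumannAlgebra H) (Ω : H) {p : H → Prop}
    (hc : IsClosed {η | p η}) (h : ∀ b ∈ M, p (b Ω)) {η : H} (hη : η ∈ orbSpace M Ω) : p η := by
  have h1 : η ∈ closure (LinearMap.range (orb M Ω) : Set H) := hη
  have h2 : closure (LinearMap.range (orb M Ω) : Set H) ⊆ {η | p η} := by
    refine closure_minimal ?_ hc
    rintro _ ⟨x, rfl⟩
    exact h x.1 x.2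
  exact h2 h1

theorem smul_mem_vN (M : VonNeumannAlgebra H) (c : ℂ) {x : H →L[ℂ] H} (hx : x ∈ M) :
    c • x ∈ M :=
  M.toStarSubalgebra.smul_mem hx c

variable {N : VonNeumannAlgebra H} {Ω : H} {J : H → H} {j : (H →L[ℂ] H) → (H →L[ℂ] H)}

theorem dense_orb (hSF : StandardForm N Ω J j) : DenseRange (orb N Ω) := by
  have h := hSF.cyclic
  refine h.mono ?_
  rintro _ ⟨x, hx, rfl⟩
  exact ⟨⟨x, hx⟩, rfl⟩

theorem norm_J (hSF : StandardForm N Ω J j) (ξ : H) : ‖J ξ‖ = ‖ξ‖ := by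
  have h := hSF.Jinner ξ ξ
  rw [inner_self_eq_norm_sq_to_K, inner_self_eq_norm_sq_to_K] at h
  have h1 : ‖J ξ‖ ^ 2 = ‖ξ‖ ^ 2 := by exact_mod_cast h
  exact (sq_eq_sq₀ (norm_nonneg _) (norm_nonneg _)).1 h1

theorem J_apply (hSF : StandardForm N Ω J j)
    (htrace : ∀ x ∈ N, ∀ y ∈ N, ⟪(x * y) Ω, Ω⟫_ℂ = ⟪(y * x) Ω, Ω⟫_ℂ)
    (x : H →L[ℂ] H) (hx : x ∈ N) : J (x Ω) = (star x) Ω := by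
  have hnorm : ∀ x ∈ N, ‖(star x) Ω‖ = ‖x Ω‖ := by
    intro x hx
    have h := htrace x hx (star x) (star_mem hx)
    simp only [mul_apply_eq_comp] at h
    have e1 : ⟪x ((star x) Ω), Ω⟫_ℂ = ⟪(star x) Ω, (star x) Ω⟫_ℂ := by
      rw [ContinuousLinearMap.star_eq_adjoint, ContinuousLinearMap.adjoint_inner_right]
    have e2 : ⟪(star x) (x Ω), Ω⟫_ℂ = ⟪x Ω, x Ω⟫_ℂ := by
      rw [ContinuousLinearMap.star_eq_adjoint, ContinuousLinearMap.adjoint_inner_left]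
    rw [e1, e2, inner_self_eq_norm_sq_to_K, inner_self_eq_norm_sq_to_K] at h
    have h1 : ‖(star x) Ω‖ ^ 2 = ‖x Ω‖ ^ 2 := by exact_mod_cast h
    exact (sq_eq_sq₀ (norm_nonneg _) (norm_nonneg _)).1 h1
  let f : N.toStarSubalgebra.toSubalgebra.toSubmodule →ₗ[ℂ] H :=
    { toFun := fun x => J ((star (x : H →L[ℂ] H)) Ω)
      map_add' := fun x y => by simp [hSF.Jadd]
      map_smul' := fun c x => by simp [hSF.Jsmul] }
  have hf : ∀ x, f x = J ((star (x : H →L[ℂ] H)) Ω) := fun x => rfl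
  have hfn : ∀ x, ‖f x‖ = ‖orb N Ω x‖ := by
    intro x
    rw [hf, norm_J hSF, hnorm _ x.2]; rfl
  let U : H →L[ℂ] H := f.extendOfNorm (orb N Ω)
  have hU : ∀ x, U (orb N Ω x) = f x :=
    LinearMap.extendOfNorm_eq (dense_orb hSF) ⟨1, fun x => by rw [one_mul, hfn]⟩
  have hU1 : ∀ ξ, ‖U ξ‖ = ‖ξ‖ := by
    intro ξ
    refine (dense_orb hSF).induction_on (p := fun ξ => ‖U ξ‖ = ‖ξ‖) ξ
      (isClosed_eq (by fun_prop) (by fun_prop)) ?_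
    intro x
    rw [hU, hfn]
  have hU2 : ∀ ξ, 0 ≤ (⟪U ξ, ξ⟫_ℂ).re ∧ (⟪U ξ, ξ⟫_ℂ).im = 0 := by
    intro ξ
    refine (dense_orb hSF).induction_on
      (p := fun ξ => 0 ≤ (⟪U ξ, ξ⟫_ℂ).re ∧ (⟪U ξ, ξ⟫_ℂ).im = 0) ξ ?_ ?_
    · have c1 : Continuous fun ξ => ⟪U ξ, ξ⟫_ℂ := by fun_prop
      exact (isClosed_le continuous_const (Complex.continuous_re.comp c1)).inter
        (isClosed_eq (Complex.continuous_im.comp c1) continuous_const)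
    · intro x
      have hxN : (x : H →L[ℂ] H) ∈ N := x.2
      have h := hSF.pos (star (x : H →L[ℂ] H)) (star_mem hxN)
      simp only [mul_apply_eq_comp, hSF.jdef, hSF.JΩ] at h
      rw [ContinuousLinearMap.star_eq_adjoint, ContinuousLinearMap.adjoint_inner_left] at h
      rw [hU, hf, orb_apply, ContinuousLinearMap.star_eq_adjoint]
      exact h
  have hsx : star x ∈ N := star_mem hx
  have h := pos_isom_eq_one U hU1 hU2 (orb N Ω ⟨star x, hsx⟩)
  rw [hU, hf, orb_apply] at h
  simpa using h

theorem j_mul (hSF : StandardForm N Ω J j) (x y : H →L[ℂ] H) : j (x * y) = j x * j y := by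
  ext ξ
  simp [hSF.jdef, hSF.Jinvol]

theorem j_j (hSF : StandardForm N Ω J j) (x : H →L[ℂ] H) : j (j x) = x := by
  ext ξ
  simp [hSF.jdef, hSF.Jinvol]

theorem j_comm (hSF : StandardForm N Ω J j) {x y : H →L[ℂ] H} (hx : x ∈ N) (hy : y ∈ N) (ξ : H) :
    j x (y ξ) = y (j x ξ) := by
  have := hSF.jmapsTo x hx y hy
  exact (congrArg (fun S : H →L[ℂ] H => S ξ) this).symm

theorem j_Ω (hSF : StandardForm N Ω J j)
    (htrace : ∀ x ∈ N, ∀ y ∈ N, ⟪(x * y) Ω, Ω⟫_ℂ = ⟪(y * x) Ω, Ω⟫_ℂ)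
    {x : H →L[ℂ] H} (hx : x ∈ N) : j x Ω = (star x) Ω := by
  rw [hSF.jdef, hSF.JΩ, J_apply hSF htrace x hx]

theorem inner_mul_mul (A B : VonNeumannAlgebra H)
    (hcomm : ∀ a ∈ A, ∀ b ∈ B, Commute a b)
    (hsplit : ∀ a ∈ A, ∀ b ∈ B, ⟪(a * b) Ω, Ω⟫_ℂ = ⟪a Ω, Ω⟫_ℂ * ⟪b Ω, Ω⟫_ℂ)
    {a a' : H →L[ℂ] H} (ha : a ∈ A) (ha' : a' ∈ A) {η η' : H}
    (hη : η ∈ orbSpace B Ω) (hη' : η' ∈ orbSpace B Ω) :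
    ⟪a η, a' η'⟫_ℂ = ⟪a Ω, a' Ω⟫_ℂ * ⟪η, η'⟫_ℂ := by
  refine orbSpace_induction B Ω (p := fun η => ⟪a η, a' η'⟫_ℂ = ⟪a Ω, a' Ω⟫_ℂ * ⟪η, η'⟫_ℂ)
    (isClosed_eq (by fun_prop) (by fun_prop)) ?_ hη
  intro b hb
  refine orbSpace_induction B Ω
    (p := fun η' => ⟪a (b Ω), a' η'⟫_ℂ = ⟪a Ω, a' Ω⟫_ℂ * ⟪b Ω, η'⟫_ℂ)
    (isClosed_eq (by fun_prop) (by fun_prop)) ?_ hη'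
  intro b' hb'
  have h := hsplit (star a' * a) (mul_mem (star_mem ha') ha) (star b' * b)
    (mul_mem (star_mem hb') hb)
  have e : star a' * a * (star b' * b) = star b' * (star a' * (a * b)) := by
    have h1 := (hcomm a ha _ (star_mem hb')).eq
    have h2 := (hcomm _ (star_mem ha') _ (star_mem hb')).eq
    calc star a' * a * (star b' * b) = star a' * (a * star b') * b := by noncomm_ring
      _ = (star a' * star b') * a * b := by rw [h1]; noncomm_ring
      _ = _ := by rw [h2]; noncomm_ring
  rw [e] at h
  simp only [mul_apply_eq_comp, ContinuousLinearMap.star_eq_adjoint,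
    ContinuousLinearMap.adjoint_inner_left] at h
  rw [← h]

theorem exists_isometry {X E K L : Type} [AddCommGroup X] [Module ℂ X]
    [NormedAddCommGroup E] [InnerProductSpace ℂ E]
    [NormedAddCommGroup K] [InnerProductSpace ℂ K]
    [NormedAddCommGroup L] [InnerProductSpace ℂ L] [CompleteSpace L]
    (e : X →ₗ[ℂ] E) (he : DenseRange e) (w : K →ₗ[ℂ] X →ₗ[ℂ] L)
    (hin : ∀ η η' x y, ⟪w η x, w η' y⟫_ℂ = ⟪e x, e y⟫_ℂ * ⟪η, η'⟫_ℂ) :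
    ∃ V : E ⊗[ℂ] K →ₗᵢ[ℂ] L, ∀ x η, V (e x ⊗ₜ η) = w η x := by
  have hfn : ∀ η x, ‖w η x‖ ≤ ‖η‖ * ‖e x‖ := by
    intro η x
    have h := hin η η x x
    rw [inner_self_eq_norm_sq_to_K, inner_self_eq_norm_sq_to_K, inner_self_eq_norm_sq_to_K] at h
    have h1 : ‖w η x‖ ^ 2 = (‖η‖ * ‖e x‖) ^ 2 := by
      rw [mul_pow, mul_comm]
      exact_mod_cast h
    exact ((sq_eq_sq₀ (norm_nonneg _) (by positivity)).1 h1).le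
  have hex : ∀ η, ∃ W : E →L[ℂ] L, ∀ x, W (e x) = w η x := fun η =>
    ⟨(w η).extendOfNorm e, fun x => LinearMap.extendOfNorm_eq he ⟨‖η‖, hfn η⟩ x⟩
  choose W hW using hex
  have hext : ∀ S T : E →L[ℂ] L, (∀ x, S (e x) = T (e x)) → ∀ ξ, S ξ = T ξ := by
    intro S T h ξ
    exact he.induction_on (p := fun ξ => S ξ = T ξ) ξ
      (isClosed_eq (by fun_prop) (by fun_prop)) h
  obtain ⟨m, hm⟩ : ∃ m : E →ₗ[ℂ] K →ₗ[ℂ] L, ∀ ξ η, m ξ η = W η ξ :=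
    ⟨LinearMap.mk₂ ℂ (fun ξ η => W η ξ)
      (fun a b η => map_add _ _ _) (fun c a η => map_smul _ _ _)
      (fun ξ a b => hext (W (a + b)) (W a + W b) (fun x => by simp [hW]) ξ)
      (fun c ξ a => hext (W (c • a)) (c • W a) (fun x => by simp [hW]) ξ), fun _ _ => rfl⟩
  have hmi : ∀ ξ ξ' η η', ⟪m ξ η, m ξ' η'⟫_ℂ = ⟪ξ, ξ'⟫_ℂ * ⟪η, η'⟫_ℂ := by
    intro ξ ξ' η η'
    rw [hm, hm]
    refine he.induction_on
      (p := fun ξ => ⟪W η ξ, W η' ξ'⟫_ℂ = ⟪ξ, ξ'⟫_ℂ * ⟪η, η'⟫_ℂ) ξ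
      (isClosed_eq (by fun_prop) (by fun_prop)) fun x => ?_
    refine he.induction_on
      (p := fun ξ' => ⟪W η (e x), W η' ξ'⟫_ℂ = ⟪e x, ξ'⟫_ℂ * ⟪η, η'⟫_ℂ) ξ'
      (isClosed_eq (by fun_prop) (by fun_prop)) fun y => ?_
    rw [hW, hW, hin]
  refine ⟨(TensorProduct.lift m).isometryOfInner ?_, ?_⟩
  · intro x y
    induction x with
    | zero => simp
    | add a b ha hb => simp only [map_add, inner_add_left, ha, hb]
    | tmul ξ η =>
      induction y with
      | zero => simp
      | add a b ha hb => simp only [map_add, inner_add_right, ha, hb]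
      | tmul ξ' η' => rw [TensorProduct.lift.tmul, TensorProduct.lift.tmul, hmi,
          TensorProduct.inner_tmul]
  · intro x η
    rw [← hW, ← hm]
    rfl

theorem exists_V (hSF : StandardForm N Ω J j) (A B : VonNeumannAlgebra H)
    (hcomm : ∀ a ∈ A, ∀ b ∈ B, Commute a b)
    (hsplit : ∀ a ∈ A, ∀ b ∈ B, ⟪(a * b) Ω, Ω⟫_ℂ = ⟪a Ω, Ω⟫_ℂ * ⟪b Ω, Ω⟫_ℂ)
    (θ : (H →L[ℂ] H) → (H →L[ℂ] H)) (hθ : StateEndo N Ω θ)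
    (hθA : ∀ x ∈ N, θ x ∈ A) :
    ∃ V : H ⊗[ℂ] (orbSpace B Ω) →ₗᵢ[ℂ] H,
      ∀ x ∈ N, ∀ η : orbSpace B Ω, V ((x Ω) ⊗ₜ η) = θ x (η : H) := by
  have hin : ∀ x ∈ N, ∀ y ∈ N, ∀ η ∈ orbSpace B Ω, ∀ η' ∈ orbSpace B Ω,
      ⟪θ x (η : H), θ y (η' : H)⟫_ℂ = ⟪x Ω, y Ω⟫_ℂ * ⟪η, η'⟫_ℂ := by
    intro x hx y hy η hη η' hη'
    rw [inner_mul_mul A B hcomm hsplit (hθA x hx) (hθA y hy) hη hη']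
    have h := hθ.state (star y * x) (mul_mem (star_mem hy) hx)
    rw [hθ.hom.map_mul _ (star_mem hy) _ hx, hθ.hom.map_star _ hy] at h
    simp only [mul_apply_eq_comp, ContinuousLinearMap.star_eq_adjoint,
      ContinuousLinearMap.adjoint_inner_left] at h
    rw [h]
  obtain ⟨w, hw⟩ : ∃ w : (orbSpace B Ω) →ₗ[ℂ]
      N.toStarSubalgebra.toSubalgebra.toSubmodule →ₗ[ℂ] H,
      ∀ η x, w η x = θ (x : H →L[ℂ] H) (η : H) := by
    refine ⟨LinearMap.mk₂ ℂ (fun η x => θ (x : H →L[ℂ] H) (η : H)) ?_ ?_ ?_ ?_, fun _ _ => rfl⟩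
    · intro a b x
      exact map_add (θ (x : H →L[ℂ] H)) _ _
    · intro c a x
      exact map_smul (θ (x : H →L[ℂ] H)) _ _
    · intro η x y
      have := hθ.hom.map_add x.1 x.2 y.1 y.2
      exact congrArg (fun S : H →L[ℂ] H => S η) this
    · intro c η x
      have := hθ.hom.map_smul c x.1 x.2
      exact congrArg (fun S : H →L[ℂ] H => S η) this
  obtain ⟨V, hV⟩ := exists_isometry (orb N Ω) (dense_orb hSF) w (by
    intro η η' x y
    rw [hw, hw, hin x.1 x.2 y.1 y.2 η.1 η.2 η'.1 η'.2]
    rfl)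
  refine ⟨V, fun x hx η => ?_⟩
  rw [← hw η ⟨x, hx⟩, ← hV]
  rfl

theorem mem_commutant_of (N A B : VonNeumannAlgebra H)
    (hgen : (N : Set (H →L[ℂ] H)) = vN ((A : Set (H →L[ℂ] H)) ∪ (B : Set (H →L[ℂ] H))))
    (T : H →L[ℂ] H) (hA : ∀ a ∈ A, a * T = T * a) (hB : ∀ b ∈ B, b * T = T * b) :
    T ∈ Set.centralizer (N : Set (H →L[ℂ] H)) := by
  rw [hgen, vN, Set.centralizer_centralizer_centralizer]
  rintro y (hy | hy)
  · exact hA y hy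
  · exact hB y hy

theorem dense_of (hSF : StandardForm N Ω J j) (A B : VonNeumannAlgebra H)
    (hcomm : ∀ a ∈ A, ∀ b ∈ B, Commute a b)
    (hgen : (N : Set (H →L[ℂ] H)) = vN ((A : Set (H →L[ℂ] H)) ∪ (B : Set (H →L[ℂ] H))))
    (D : Submodule ℂ H) (hD : IsClosed (D : Set H)) (hAB : ∀ a ∈ A, ∀ b ∈ B, a (b Ω) ∈ D) :
    D = ⊤ := by
  let S : Set H := {ξ | ∃ a ∈ A, ∃ b ∈ B, a (b Ω) = ξ}
  let D' : Submodule ℂ H := (Submodule.span ℂ S).topologicalClosure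
  have hle : D' ≤ D := Submodule.topologicalClosure_minimal _ (by
    rw [Submodule.span_le]; rintro _ ⟨a, ha, b, hb, rfl⟩; exact hAB a ha b hb) hD
  have hD'c : IsClosed (D' : Set H) := Submodule.isClosed_topologicalClosure _
  have : CompleteSpace D' := hD'c.completeSpace_coe
  have hinv : ∀ g : H →L[ℂ] H, (∀ ξ ∈ S, g ξ ∈ S) → ∀ ξ ∈ D', g ξ ∈ D' := by
    intro g hg
    have h1 : D' ≤ D'.comap g.toLinearMap := by
      refine Submodule.topologicalClosure_minimal _ ?_ (hD'c.preimage g.continuous)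
      rw [Submodule.span_le]
      intro ξ hξ
      exact Submodule.le_topologicalClosure _ (Submodule.subset_span (hg ξ hξ))
    exact h1
  have hA : ∀ a ∈ A, ∀ ξ ∈ D', a ξ ∈ D' := by
    intro a ha
    refine hinv a ?_
    rintro _ ⟨a', ha', b, hb, rfl⟩
    exact ⟨a * a', mul_mem ha ha', b, hb, rfl⟩
  have hB : ∀ b ∈ B, ∀ ξ ∈ D', b ξ ∈ D' := by
    intro b hb
    refine hinv b ?_
    rintro _ ⟨a', ha', b', hb', rfl⟩
    refine ⟨a', ha', b * b', mul_mem hb hb', ?_⟩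
    exact congrArg (fun S : H →L[ℂ] H => S (b' Ω)) (hcomm a' ha' b hb).eq
  have hP : ∀ g : H →L[ℂ] H, (∀ ξ ∈ D', g ξ ∈ D') → (∀ ξ ∈ D', (star g) ξ ∈ D') →
      g * D'.starProjection = D'.starProjection * g := by
    intro g h1 h2
    ext ξ
    simp only [mul_apply_eq_comp]
    symm
    refine Submodule.eq_starProjection_of_mem_of_inner_eq_zero (h1 _ (Submodule.starProjection_apply_mem _ _)) ?_
    intro w hw
    rw [← map_sub, ← ContinuousLinearMap.adjoint_inner_right, ← ContinuousLinearMap.star_eq_adjoint]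
    exact Submodule.starProjection_inner_eq_zero _ _ (h2 w hw)
  have hPN : D'.starProjection ∈ Set.centralizer (N : Set (H →L[ℂ] H)) :=
    mem_commutant_of N A B hgen _ (fun a ha => hP a (hA a ha) (hA _ (star_mem ha)))
      (fun b hb => hP b (hB b hb) (hB _ (star_mem hb)))
  have hΩ : Ω ∈ D' := Submodule.le_topologicalClosure _
    (Submodule.subset_span ⟨1, one_mem _, 1, one_mem _, rfl⟩)
  have hΩ' : D'.starProjection Ω = Ω := Submodule.starProjection_eq_self_iff.2 hΩ
  rw [eq_top_iff]
  refine le_trans ?_ hle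
  intro ξ _
  refine (dense_orb hSF).induction_on (p := fun ξ => ξ ∈ D') ξ hD'c fun x => ?_
  have h1 := congrArg (fun S : H →L[ℂ] H => S Ω) (hPN x.1 x.2)
  simp only [mul_apply_eq_comp, hΩ'] at h1
  rw [orb_apply, h1]
  exact Submodule.starProjection_apply_mem _ _

end Concrete
/-- **Section 4 example.**  Let `N` (playing the role of `M ⊗ R`, with `M` a McDuff `II₁`
factor and `R` the hyperfinite `II₁` factor) be a `II₁` factor in standard form with respect to
its trace vector `Ω`, which is generated by two commuting subfactors `A` (≅ `M ⊗ 1`) and `B`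
(≅ `1 ⊗ R`) with the trace factorizing over products (so that `N ≅ A ⊗ B`), and let `θ` be a
trace-preserving endomorphism of `N` with image `θ(N) = A` (namely `θ = β ∘ α` with
`α : M ⊗ R → M` an isomorphism and `β(m) = m ⊗ 1`).  Then
`θ(N) ∨ J θ(N) J = B(L²(M)) ⊗ 1` (the commutant of `B ∨ JBJ`) is a type `I` factor, and hence
`θ` is extendable (with respect to the trace). -/
theorem mcduff_example
    (N : VonNeumannAlgebra H) (Ω : H) (J : H → H) (j : (H →L[ℂ] H) → (H →L[ℂ] H))
    (hSF : StandardForm N Ω J j) (hN : IsFactorSet (N : Set (H →L[ℂ] H)))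
    -- the vector state of `Ω` is a trace on `N`, and `N` is infinite-dimensional (type `II₁`):
    (htrace : ∀ x ∈ N, ∀ y ∈ N, ⟪(x * y) Ω, Ω⟫_ℂ = ⟪(y * x) Ω, Ω⟫_ℂ)
    (hinfdim : ¬ ∃ s : Finset (H →L[ℂ] H),
      (N : Set (H →L[ℂ] H)) ⊆ (Submodule.span ℂ (s : Set (H →L[ℂ] H)) : Set (H →L[ℂ] H)))
    -- the commuting subfactors `A = M ⊗ 1` and `B = 1 ⊗ R` exhibiting `N = M ⊗ R`:
    (A B : VonNeumannAlgebra H)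
    (hAN : (A : Set (H →L[ℂ] H)) ⊆ (N : Set (H →L[ℂ] H)))
    (hBN : (B : Set (H →L[ℂ] H)) ⊆ (N : Set (H →L[ℂ] H)))
    (hAfactor : IsFactorSet (A : Set (H →L[ℂ] H)))
    (hBfactor : IsFactorSet (B : Set (H →L[ℂ] H)))
    (hcomm : ∀ a ∈ A, ∀ b ∈ B, Commute a b)
    (hgen : (N : Set (H →L[ℂ] H)) = vN ((A : Set (H →L[ℂ] H)) ∪ (B : Set (H →L[ℂ] H))))
    (hsplit : ∀ a ∈ A, ∀ b ∈ B, ⟪(a * b) Ω, Ω⟫_ℂ = ⟪a Ω, Ω⟫_ℂ * ⟪b Ω, Ω⟫_ℂ)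
    -- `θ` is a trace-preserving endomorphism of `N` with `θ(N) = A` (e.g. `θ = β ∘ α`):
    (θ : (H →L[ℂ] H) → (H →L[ℂ] H)) (hθ : StateEndo N Ω θ)
    (hθim : θ '' (N : Set (H →L[ℂ] H)) = (A : Set (H →L[ℂ] H))) :
    -- `θ(N) ∨ J θ(N) J = B(L²(M)) ⊗ 1 = (B ∨ JBJ)′` ...
    vN ((θ '' (N : Set (H →L[ℂ] H))) ∪ (j '' (θ '' (N : Set (H →L[ℂ] H))))) =
      Set.centralizer ((B : Set (H →L[ℂ] H)) ∪ (j '' (B : Set (H →L[ℂ] H)))) ∧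
    -- ... is a type `I` factor ...
    IsTypeIFactorSet
      (vN ((θ '' (N : Set (H →L[ℂ] H))) ∪ (j '' (θ '' (N : Set (H →L[ℂ] H)))))) ∧
    -- ... and hence `θ` is extendable:
    Extendable N j θ := by
  have hθA : ∀ x ∈ N, θ x ∈ A := fun x hx => by
    have : θ x ∈ θ '' (N : Set (H →L[ℂ] H)) := ⟨x, hx, rfl⟩
    rw [hθim] at this
    exact this
  have hAθ : ∀ a ∈ A, ∃ x ∈ N, θ x = a := fun a ha => by
    have : a ∈ θ '' (N : Set (H →L[ℂ] H)) := by rw [hθim]; exact ha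
    exact this
  obtain ⟨V, hVx⟩ := exists_V hSF A B hcomm hsplit θ hθ hθA
  have hV : DenseRange V := by
    have htop := dense_of hSF A B hcomm hgen (LinearMap.range V.toLinearMap).topologicalClosure
      (Submodule.isClosed_topologicalClosure _) (by
        intro a ha b hb
        obtain ⟨x, hx, rfl⟩ := hAθ a ha
        refine Submodule.le_topologicalClosure _ ⟨(x Ω) ⊗ₜ ⟨b Ω, mem_orbSpace B Ω hb⟩, ?_⟩
        exact hVx x hx _)
    have h1 : Dense ((LinearMap.range V.toLinearMap : Submodule ℂ H) : Set H) :=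
      Submodule.dense_iff_topologicalClosure_eq_top.2 htop
    have h2 : ((LinearMap.range V.toLinearMap : Submodule ℂ H) : Set H) = Set.range V := rfl
    rw [h2] at h1
    exact h1
  -- checking vectors on the dense orbit
  have hextξ : ∀ S : H →L[ℂ] H, ∀ F : (orbSpace B Ω) →L[ℂ] (orbSpace B Ω), ∀ g : H →L[ℂ] H,
      (∀ x ∈ N, ∀ η, g (V ((x Ω) ⊗ₜ η)) = V ((S (x Ω)) ⊗ₜ F η)) → g = tens V S F := by
    intro S F g h
    refine ext_V V hV fun ξ η => ?_
    rw [tens_tmul V hV]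
    have hc : Continuous fun ξ : H => V ((S ξ) ⊗ₜ[ℂ] F η) :=
      (V.toContinuousLinearMap ∘L ((TensorProduct.mkL ℂ H (orbSpace B Ω)).flip (F η)) ∘L S).continuous
    have hc2 : Continuous fun ξ : H => g (V (ξ ⊗ₜ[ℂ] η)) :=
      (g ∘L V.toContinuousLinearMap ∘L ((TensorProduct.mkL ℂ H (orbSpace B Ω)).flip η)).continuous
    exact (dense_orb hSF).induction_on (p := fun ξ => g (V (ξ ⊗ₜ[ℂ] η)) = V ((S ξ) ⊗ₜ[ℂ] F η)) ξ
      (isClosed_eq hc2 hc) fun x => h x.1 x.2 η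
  have hθt : ∀ x ∈ N, θ x = tens V x 1 := by
    intro x hx
    refine hextξ x 1 _ fun y hy η => ?_
    have h1 := hVx (x * y) (mul_mem hx hy) η
    rw [hθ.hom.map_mul x hx y hy] at h1
    rw [hVx y hy]
    exact h1.symm
  have hjη : ∀ a ∈ A, ∀ η ∈ orbSpace B Ω, j a η = (star a) η := by
    intro a ha η hη
    refine orbSpace_induction B Ω (p := fun η => j a η = (star a) η)
      (isClosed_eq (by fun_prop) (by fun_prop)) ?_ hη
    intro b hb
    rw [j_comm hSF (hAN ha) (hBN hb), j_Ω hSF htrace (hAN ha)]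
    exact (congrArg (fun S : H →L[ℂ] H => S Ω) (hcomm _ (star_mem ha) b hb).eq).symm
  have hjθt : ∀ x ∈ N, j (θ x) = tens V (j x) 1 := by
    intro x hx
    refine hextξ (j x) 1 _ fun y hy η => ?_
    rw [hVx y hy, j_comm hSF (hAN (hθA x hx)) (hAN (hθA y hy)), hjη _ (hθA x hx) _ η.2,
      j_comm hSF hx hy, j_Ω hSF htrace hx, ← hθ.hom.map_star x hx]
    have h1 := hVx (y * star x) (mul_mem hy (star_mem hx)) η
    rw [hθ.hom.map_mul y hy _ (star_mem hx)] at h1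
    exact h1.symm
  -- restriction of `B` and `JBJ` to `L²(B)`
  have hrestr : ∀ g : H →L[ℂ] H, (∀ a ∈ A, ∀ ξ, g (a ξ) = a (g ξ)) →
      (∀ b ∈ B, g (b Ω) ∈ orbSpace B Ω) → ∃ G : (orbSpace B Ω) →L[ℂ] (orbSpace B Ω),
      g = tens V 1 G := by
    intro g hgA hgB
    have hg : ∀ η ∈ orbSpace B Ω, g η ∈ orbSpace B Ω := fun η hη =>
      orbSpace_induction B Ω (p := fun η => g η ∈ orbSpace B Ω)
        ((Submodule.isClosed_topologicalClosure _).preimage g.continuous) hgB hη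
    refine ⟨(g ∘L (orbSpace B Ω).subtypeL).codRestrict (orbSpace B Ω) (fun η => hg η.1 η.2), ?_⟩
    refine hextξ 1 _ _ fun y hy η => ?_
    rw [hVx y hy, hgA _ (hθA y hy)]
    exact (hVx y hy ⟨g η, hg η.1 η.2⟩).symm
  have hBt : ∀ b ∈ B, ∃ G, b = tens V 1 G := fun b hb =>
    hrestr b (fun a ha ξ => (congrArg (fun S : H →L[ℂ] H => S ξ) (hcomm a ha b hb).eq).symm)
      (fun b' hb' => mem_orbSpace B Ω (mul_mem hb hb'))
  have hjBt : ∀ b ∈ B, ∃ G, j b = tens V 1 G := fun b hb =>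
    hrestr (j b) (fun a ha ξ => j_comm hSF (hBN hb) (hAN ha) ξ)
      (fun b' hb' => by
        rw [j_comm hSF (hBN hb) (hBN hb'), j_Ω hSF htrace (hBN hb)]
        exact mem_orbSpace B Ω (mul_mem hb' (star_mem hb)))
  let SN : Set (H →L[ℂ] H) := (N : Set (H →L[ℂ] H)) ∪ j '' (N : Set (H →L[ℂ] H))
  let SK : Set ((orbSpace B Ω) →L[ℂ] (orbSpace B Ω)) :=
    {G | tens V 1 G ∈ (B : Set (H →L[ℂ] H)) ∪ (j '' (B : Set (H →L[ℂ] H)))}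
  have hSA : (fun T => tens V T 1) '' SN =
      (θ '' (N : Set (H →L[ℂ] H))) ∪ (j '' (θ '' (N : Set (H →L[ℂ] H)))) := by
    rw [Set.image_union, Set.image_image, Set.image_image]
    congr 1
    · exact Set.image_congr fun x hx => (hθt x hx).symm
    · exact Set.image_congr fun x hx => (hjθt x hx).symm
  have hSB : (fun G => tens V 1 G) '' SK =
      (B : Set (H →L[ℂ] H)) ∪ (j '' (B : Set (H →L[ℂ] H))) := by
    apply Set.Subset.antisymm
    · rintro _ ⟨G, hG, rfl⟩
      exact hG
    · intro g hg
      have : ∃ G, g = tens V 1 G := by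
        rcases hg with hg | ⟨b, hb, rfl⟩
        · exact hBt g hg
        · exact hjBt b hb
      obtain ⟨G, rfl⟩ := this
      exact ⟨G, hg, rfl⟩
  have hscalar : ∀ T ∈ N, T ∈ Set.centralizer (N : Set (H →L[ℂ] H)) →
      ∃ c : ℂ, T = c • (1 : H →L[ℂ] H) := fun T hT hT' =>
    hN T hT fun y hy => (hT' y hy).symm
  have hirrN : ∀ T ∈ Set.centralizer SN, ∃ c : ℂ, T = c • (1 : H →L[ℂ] H) := by
    intro T hT
    refine hscalar T ?_ (fun y hy => hT y (Or.inl hy))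
    have : T ∈ Set.centralizer (Set.centralizer (N : Set (H →L[ℂ] H))) := by
      intro y hy
      obtain ⟨x, hx, rfl⟩ := hSF.jsurj y hy
      exact hT _ (Or.inr ⟨x, hx, rfl⟩)
    rw [VonNeumannAlgebra.centralizer_centralizer] at this
    exact this
  have hirrL : ∀ T ∈ Set.centralizer
      (((fun T => tens V T 1) '' SN) ∪ ((fun G => tens V 1 G) '' SK)),
      ∃ c : ℂ, T = c • (1 : H →L[ℂ] H) := by
    rw [hSA, hSB, hθim]
    intro T hT
    refine hscalar T ?_ ?_
    · have hjT : j T ∈ Set.centralizer (N : Set (H →L[ℂ] H)) := by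
        refine mem_commutant_of N A B hgen _ ?_ ?_
        · intro a ha
          have h1 := hT (j a) (Or.inl (Or.inr ⟨a, ha, rfl⟩))
          have h2 := congrArg j h1
          rwa [j_mul hSF, j_mul hSF, j_j hSF] at h2
        · intro a ha
          have h1 := hT (j a) (Or.inr (Or.inr ⟨a, ha, rfl⟩))
          have h2 := congrArg j h1
          rwa [j_mul hSF, j_mul hSF, j_j hSF] at h2
      obtain ⟨x, hx, hxT⟩ := hSF.jsurj _ hjT
      have h3 := congrArg j hxT
      rw [j_j hSF, j_j hSF] at h3
      rw [← h3]
      exact hx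
    · exact mem_commutant_of N A B hgen _ (fun a ha => hT a (Or.inl (Or.inl ha)))
        (fun b hb => hT b (Or.inr (Or.inl hb)))
  let η₀ : orbSpace B Ω := ⟨Ω, mem_orbSpace B Ω (one_mem B)⟩
  have hη₀ : ‖η₀‖ = 1 := hSF.unit
  have hR1 : Set.centralizer ((fun G => tens V 1 G) '' SK) ⊆
      Set.range (fun T : H →L[ℂ] H => tens V T 1) := by
    intro T hT
    obtain ⟨R, hR⟩ := core_sub_range V hV Ω hSF.unit η₀ hη₀ SN SK hirrL T hT
    exact ⟨R, hR.symm⟩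
  have hR2 : Set.range (fun T : H →L[ℂ] H => tens V T 1) ⊆
      vN ((fun T => tens V T 1) '' SN) := by
    rintro _ ⟨R, rfl⟩
    exact core_range_sub V hV SN hirrN R
  have hR3 : vN ((fun T => tens V T 1) '' SN) ⊆
      Set.centralizer ((fun G => tens V 1 G) '' SK) := by
    refine Set.centralizer_subset ?_
    rintro _ ⟨G, _, rfl⟩ _ ⟨T, _, rfl⟩
    show tens V T 1 * tens V 1 G = tens V 1 G * tens V T 1
    rw [← tens_mul2 V hV, ← tens_mul2 V hV]
    simp
  have hvN : vN ((fun T => tens V T 1) '' SN) = Set.range (fun T : H →L[ℂ] H => tens V T 1) :=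
    Set.Subset.antisymm (hR3.trans hR1) hR2
  rw [← hSA, ← hSB]
  refine ⟨Set.Subset.antisymm hR3 (hR1.trans hR2), ?_, ?_⟩
  · rw [hvN]
    exact core_typeI V hV Ω hSF.unit η₀ hη₀
  · refine ⟨fun T => tens V T 1, ?_, tens_one V hV, tens_normal V hV, ?_, ?_⟩
    · exact ⟨fun x _ y _ => tens_add V hV x y, fun c x _ => tens_smul V hV c x,
        fun x _ y _ => tens_mul V hV x y, fun x _ => tens_star V hV x⟩
    · intro x hx
      exact (hθt x hx).symm
    · intro x hx
      exact (hjθt x hx).symm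

end Paper
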